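/- arXiv:2005.12603 — 3 statements merged into one kernel-verified Lean document; each statement's English description precedes it below -/
import Mathlib

section
/- For every integer n ≥ 1 and every balanced necklace with n red and n blue beads, there exists a cross-free homogeneous matching of size n − 1, i.e., a non-crossing matching of n − 1 same-colored pairs, covering all but two beads (no secant-respecting condition is imposed). -/
def strictBtw {N : ℕ} (a x b : Fin N) : Prop :=
  0 < (x - a).val ∧ (x - a).val < (b - a).val

def Crosses {N : ℕ} (p q : Fin N × Fin N) : Prop :=
  (strictBtw p.1 q.1 p.2 ∧ strictBtw p.2 q.2 p.1) ∨
  (strictBtw p.1 q.2 p.2 ∧ strictBtw p.2 q.1 p.1)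

def IsMatching {N : ℕ} (M : Finset (Fin N × Fin N)) : Prop :=
  (∀ p ∈ M, p.1 ≠ p.2) ∧
  ∀ p ∈ M, ∀ q ∈ M, p ≠ q →
    p.1 ≠ q.1 ∧ p.1 ≠ q.2 ∧ p.2 ≠ q.1 ∧ p.2 ≠ q.2

def CrossFree {N : ℕ} (M : Finset (Fin N × Fin N)) : Prop :=
  ∀ p ∈ M, ∀ q ∈ M, ¬ Crosses p q

def InArc {N : ℕ} (k : Fin N) (m : ℕ) (x : Fin N) : Prop :=
  (x - k).val < m

def RespectsSecant {N : ℕ} (M : Finset (Fin N × Fin N)) (k : Fin N) (m : ℕ) : Prop :=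
  0 < m ∧ m < N ∧ ∀ p ∈ M, Xor' (InArc k m p.1) (InArc k m p.2)

def SecantRespecting {N : ℕ} (M : Finset (Fin N × Fin N)) : Prop :=
  ∃ k m, RespectsSecant M k m

def IsProper {N : ℕ} (M : Finset (Fin N × Fin N)) : Prop :=
  CrossFree M ∧ SecantRespecting M

def Heterogeneous {N : ℕ} (c : Fin N → Bool) (M : Finset (Fin N × Fin N)) : Prop :=
  ∀ p ∈ M, c p.1 ≠ c p.2

def Homogeneous {N : ℕ} (c : Fin N → Bool) (M : Finset (Fin N × Fin N)) : Prop :=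
  ∀ p ∈ M, c p.1 = c p.2

def redCount {N : ℕ} (c : Fin N → Bool) : ℕ :=
  (Finset.univ.filter fun i => c i = true).card

def monoCount {N : ℕ} (c : Fin N → Bool) : ℕ :=
  (Finset.univ.filter fun i : Fin N =>
    c i ≠ c ⟨(i.val + 1) % N, Nat.mod_lt _ i.pos⟩).card

theorem strictBtw_iff_of_lt {N : ℕ} {a b x : Fin N} (h : a < b) :
    strictBtw a x b ↔ a < x ∧ x < b := by
  simp only [strictBtw, Fin.lt_def] at *
  rcases le_or_gt a x with hx | hx
  · rw [Fin.sub_val_of_le hx, Fin.sub_val_of_le (Fin.le_def.2 h.le)]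
    rw [Fin.le_def] at hx
    omega
  · rw [Fin.coe_sub_iff_lt.2 hx, Fin.sub_val_of_le (Fin.le_def.2 h.le)]
    rw [Fin.lt_def] at hx
    omega

theorem strictBtw_iff_of_gt {N : ℕ} {a b x : Fin N} (h : a < b) :
    strictBtw b x a ↔ x < a ∨ b < x := by
  simp only [strictBtw]
  rw [Fin.coe_sub_iff_lt.2 h]
  rcases le_or_gt b x with hx | hx
  · rw [Fin.sub_val_of_le hx]
    simp only [Fin.lt_def, Fin.le_def] at *
    omega
  · rw [Fin.coe_sub_iff_lt.2 hx]
    simp only [Fin.lt_def] at *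
    omega

theorem crosses_iff_of_lt {N : ℕ} {a b : Fin N} {q : Fin N × Fin N} (h : a < b) :
    Crosses (a, b) q ↔
      ((a < q.1 ∧ q.1 < b) ∧ (q.2 < a ∨ b < q.2)) ∨
      ((a < q.2 ∧ q.2 < b) ∧ (q.1 < a ∨ b < q.1)) := by
  simp only [Crosses, strictBtw_iff_of_lt h, strictBtw_iff_of_gt h]

theorem exists_eq_succ_or_eq_last (p : ℕ → Bool) (k : ℕ) :
    (∃ i < 2 * k, p i = p (i + 1)) ∨ p 0 = p (2 * k) := by
  induction k with
  | zero => simp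
  | succ k ih =>
    rcases ih with ⟨i, hi, h⟩ | h
    · exact .inl ⟨i, by omega, h⟩
    · by_cases h1 : p (2 * k) = p (2 * k + 1)
      · exact .inl ⟨2 * k, by omega, h1⟩
      · by_cases h2 : p (2 * k + 1) = p (2 * k + 1 + 1)
        · exact .inl ⟨2 * k + 1, by omega, h2⟩
        · right
          rw [h, show 2 * (k + 1) = 2 * k + 1 + 1 by ring]
          revert h1 h2
          cases p (2 * k) <;> cases p (2 * k + 1) <;> cases p (2 * k + 1 + 1) <;> simp

/-- In an odd set of at least three beads, some two cyclically consecutive beads have the same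
color. -/
theorem exists_consecutive_same_color {α : Type*} [LinearOrder α] (c : α → Bool) {k : ℕ}
    (hk : 0 < k) {S : Finset α} (hS : S.card = 2 * k + 1) :
    ∃ a ∈ S, ∃ b ∈ S, a < b ∧ c a = c b ∧
      ((∀ x ∈ S, x ≤ a ∨ b ≤ x) ∨ ∀ x ∈ S, a ≤ x ∧ x ≤ b) := by
  let f := S.orderEmbOfFin hS
  have hf : ∀ x ∈ S, ∃ i, f i = x := fun x hx => by
    have : x ∈ Set.range f := by rw [Finset.range_orderEmbOfFin]; exact hx
    exact this
  rcases exists_eq_succ_or_eq_last (fun i => c (f (Fin.ofNat _ i))) k with ⟨i, hi, h⟩ | h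
  · refine ⟨_, S.orderEmbOfFin_mem hS _, _, S.orderEmbOfFin_mem hS _, ?_, h, .inl ?_⟩
    · refine f.lt_iff_lt.2 (Fin.lt_def.2 ?_)
      simp only [Fin.val_ofNat]
      rw [Nat.mod_eq_of_lt (by omega), Nat.mod_eq_of_lt (by omega)]
      omega
    · intro x hx
      obtain ⟨j, rfl⟩ := hf x hx
      refine (f.le_iff_le.or f.le_iff_le).2 ?_
      simp only [Fin.le_def, Fin.val_ofNat]
      rw [Nat.mod_eq_of_lt (by omega), Nat.mod_eq_of_lt (by omega)]
      omega
  · refine ⟨_, S.orderEmbOfFin_mem hS _, _, S.orderEmbOfFin_mem hS _, ?_, h, .inr ?_⟩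
    · refine f.lt_iff_lt.2 (Fin.lt_def.2 ?_)
      simp only [Fin.val_ofNat]
      rw [Nat.mod_eq_of_lt (by omega), Nat.mod_eq_of_lt (by omega)]
      omega
    · intro x hx
      obtain ⟨j, rfl⟩ := hf x hx
      refine (f.le_iff_le.and f.le_iff_le).2 ?_
      simp only [Fin.le_def, Fin.val_ofNat]
      rw [Nat.mod_eq_of_lt (by omega), Nat.mod_eq_of_lt (by omega)]
      omega

/-- Any set of `2 * k + 1` beads, however colored, carries a cross-free homogeneous matching
with `k` pairs. -/
theorem exists_matching_of_card_odd {N : ℕ} (c : Fin N → Bool) (k : ℕ) (S : Finset (Fin N))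
    (hS : S.card = 2 * k + 1) :
    ∃ M : Finset (Fin N × Fin N), (∀ p ∈ M, p.1 ∈ S ∧ p.2 ∈ S) ∧ (∀ p ∈ M, p.1 < p.2) ∧
      IsMatching M ∧ CrossFree M ∧ Homogeneous c M ∧ M.card = k := by
  induction k generalizing S with
  | zero => exact ⟨∅, by simp [IsMatching, CrossFree, Homogeneous]⟩
  | succ k ih =>
    obtain ⟨a, ha, b, hb, hab, hc, hsep⟩ := exists_consecutive_same_color c k.succ_pos hS
    have hcard : ((S.erase a).erase b).card = 2 * k + 1 := by
      rw [Finset.card_erase_of_mem (Finset.mem_erase.2 ⟨hab.ne', hb⟩),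
        Finset.card_erase_of_mem ha]
      omega
    obtain ⟨M, hMS, hlt, hM, hcross, hhom, hMk⟩ := ih _ hcard
    have hmem : ∀ p ∈ M, (p.1 ≠ a ∧ p.1 ≠ b ∧ p.1 ∈ S) ∧ p.2 ≠ a ∧ p.2 ≠ b ∧ p.2 ∈ S := by
      intro p hp
      have := hMS p hp
      simp only [Finset.mem_erase] at this
      tauto
    have hnew : (a, b) ∉ M := fun h => (hmem _ h).1.1 rfl
    refine ⟨insert (a, b) M, ?_, ?_, ⟨?_, ?_⟩, ?_, ?_,
      by rw [Finset.card_insert_of_notMem hnew, hMk]⟩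
    · simp only [Finset.forall_mem_insert]
      exact ⟨⟨ha, hb⟩, fun p hp => ⟨(hmem p hp).1.2.2, (hmem p hp).2.2.2⟩⟩
    · simp only [Finset.forall_mem_insert]
      exact ⟨hab, hlt⟩
    · simp only [Finset.forall_mem_insert]
      exact ⟨hab.ne, hM.1⟩
    · simp only [Finset.forall_mem_insert]
      refine ⟨⟨fun h => absurd rfl h, fun q hq _ => ?_⟩, fun p hp => ⟨fun _ => ?_, hM.2 p hp⟩⟩
      · obtain ⟨⟨h1, h2, -⟩, h3, h4, -⟩ := hmem q hq
        exact ⟨h1.symm, h3.symm, h2.symm, h4.symm⟩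
      · obtain ⟨⟨h1, h2, -⟩, h3, h4, -⟩ := hmem p hp
        exact ⟨h1, h2, h3, h4⟩
    · simp only [CrossFree, Finset.forall_mem_insert]
      refine ⟨⟨?_, fun q hq => ?_⟩, fun p hp => ⟨?_, hcross p hp⟩⟩
      · rw [crosses_iff_of_lt hab]
        simp
      · rw [crosses_iff_of_lt hab]
        obtain ⟨⟨-, -, h1⟩, -, -, h2⟩ := hmem q hq
        rcases hsep with h | h <;> have := h _ h1 <;> have := h _ h2 <;> grind
      · rw [← Prod.mk.eta (p := p), crosses_iff_of_lt (hlt p hp)]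
        obtain ⟨⟨-, -, h1⟩, -, -, h2⟩ := hmem p hp
        rcases hsep with h | h <;> have := h _ h1 <;> have := h _ h2 <;> grind
    · simp only [Homogeneous, Finset.forall_mem_insert]
      exact ⟨hc, hhom⟩

/-- every balanced necklace with n red and n blue beads has a
cross-free homogeneous matching of size n - 1. -/
theorem stmt3 (n : ℕ) (hn : 1 ≤ n) (c : Fin (2 * n) → Bool) (hbal : redCount c = n) :
    ∃ M : Finset (Fin (2 * n) × Fin (2 * n)),
      IsMatching M ∧ CrossFree M ∧ Homogeneous c M ∧ M.card = n - 1 := by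
  obtain ⟨S, -, hS⟩ := Finset.exists_subset_card_eq
    (s := (Finset.univ : Finset (Fin (2 * n)))) (n := 2 * (n - 1) + 1)
    (by rw [Finset.card_univ, Fintype.card_fin]; omega)
  obtain ⟨M, -, -, hM, hcross, hc, hcard⟩ := exists_matching_of_card_odd c (n - 1) S hS
  exact ⟨M, hM, hcross, hc, hcard⟩
end

section
/- For every ε > 0 and every N₀, there exist an even integer N ≥ N₀, with N = 2n, and a balanced necklace L with n red and n blue beads, such that mono(L) ≤ ε·N and every proper homogeneous matching of L has size at most (2 − √2 + ε)·n (equivalently, covers at most (2 − √2 + ε)·N beads). -/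
/-- The integer points of the convex hull of the image of `S` under `f`. -/
def intHull {ι : Type*} (S : Finset ι) (f : ι → ℕ) : Finset ℕ :=
  S.biUnion fun p => S.biUnion fun q => Finset.Icc (f p) (f q)

lemma mem_intHull {ι : Type*} {S : Finset ι} {f : ι → ℕ} {z : ℕ} :
    z ∈ intHull S f ↔ (∃ p ∈ S, f p ≤ z) ∧ ∃ q ∈ S, z ≤ f q := by
  simp only [intHull, Finset.mem_biUnion, Finset.mem_Icc]
  constructor
  · rintro ⟨p, hp, q, hq, h1, h2⟩
    exact ⟨⟨p, hp, h1⟩, q, hq, h2⟩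
  · rintro ⟨⟨p, hp, h1⟩, q, hq, h2⟩
    exact ⟨p, hp, q, hq, h1, h2⟩

lemma intHull_eq_Ico {ι : Type*} (S : Finset ι) (f : ι → ℕ) :
    ∃ x l, intHull S f = Finset.Ico x (x + l) := by
  rcases S.eq_empty_or_nonempty with rfl | hS
  · exact ⟨0, 0, by simp [intHull]⟩
  · obtain ⟨p, hp, hmin⟩ := S.exists_min_image f hS
    obtain ⟨q, hq, hmax⟩ := S.exists_max_image f hS
    have hpq := hmin q hq
    refine ⟨f p, f q + 1 - f p, ?_⟩
    ext z
    rw [mem_intHull, Finset.mem_Ico]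
    constructor
    · rintro ⟨⟨u, hu, h1⟩, v, hv, h2⟩
      have := hmin u hu
      have := hmax v hv
      omega
    · rintro ⟨h1, h2⟩
      exact ⟨⟨p, hp, h1⟩, q, hq, by omega⟩

lemma intHull_subset_Ico {ι : Type*} {S : Finset ι} {f : ι → ℕ} {x y : ℕ}
    (h : ∀ p ∈ S, x ≤ f p ∧ f p < y) : intHull S f ⊆ Finset.Ico x y := by
  intro z hz
  obtain ⟨⟨p, hp, h1⟩, q, hq, h2⟩ := mem_intHull.1 hz
  have := h p hp
  have := h q hq
  rw [Finset.mem_Ico]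
  omega

lemma sum_card_intHull_fiber_le {ι : Type*} (S : Finset ι) (f : ι → ℕ) (g : ι → ℤ)
    (h : (∀ p ∈ S, ∀ q ∈ S, g p < g q → f p < f q) ∨
      ∀ p ∈ S, ∀ q ∈ S, g p < g q → f q < f p) :
    ∑ v ∈ S.image g, (intHull (S.filter fun p => g p = v) f).card ≤ (intHull S f).card := by
  rw [← Finset.card_biUnion]
  · apply Finset.card_le_card
    intro z hz
    simp only [Finset.mem_biUnion, mem_intHull, Finset.mem_filter] at hz ⊢
    obtain ⟨v, -, ⟨p, hp, h1⟩, q, hq, h2⟩ := hz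
    exact ⟨⟨p, hp.1, h1⟩, q, hq.1, h2⟩
  · intro v _ w _ hvw
    rw [Function.onFun, Finset.disjoint_left]
    intro z hz hz'
    simp only [mem_intHull, Finset.mem_filter] at hz hz'
    obtain ⟨⟨p, hp, h1⟩, q, hq, h2⟩ := hz
    obtain ⟨⟨p', hp', h1'⟩, q', hq', h2'⟩ := hz'
    rcases h with h | h <;> rcases lt_or_gt_of_ne hvw with hlt | hlt
    · have := h q hq.1 p' hp'.1 (by omega); omega
    · have := h q' hq'.1 p hp.1 (by omega); omega
    · have := h p hp.1 q' hq'.1 (by omega); omega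
    · have := h p' hp'.1 q hq.1 (by omega); omega

/-- Summing a bound on the fibres of a monotone key over the whole set. -/
lemma sum_le_card_intHull_add {ι : Type*} (S : Finset ι) (f : ι → ℕ) (g : ι → ℤ)
    (h : (∀ p ∈ S, ∀ q ∈ S, g p < g q → f p < f q) ∨
      ∀ p ∈ S, ∀ q ∈ S, g p < g q → f q < f p) (w : ι → ℝ) (E : ℝ)
    (hw : ∀ v ∈ S.image g, ∑ p ∈ S.filter (fun p => g p = v), w p ≤
      (intHull (S.filter fun p => g p = v) f).card + E) :
    ∑ p ∈ S, w p ≤ (intHull S f).card + (S.image g).card * E := by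
  rw [← Finset.sum_fiberwise_of_maps_to (fun p hp => Finset.mem_image_of_mem g hp)]
  refine (Finset.sum_le_sum hw).trans ?_
  rw [Finset.sum_add_distrib, Finset.sum_const, nsmul_eq_mul]
  gcongr
  exact_mod_cast sum_card_intHull_fiber_le S f g h

lemma card_image_le_of_mem_Ico {ι : Type*} {S : Finset ι} {g : ι → ℤ} {x : ℤ} {l : ℕ}
    (h : ∀ p ∈ S, x ≤ g p ∧ g p < x + l) : (S.image g).card ≤ l := by
  have : S.image g ⊆ Finset.Ico x (x + l) := by
    intro v hv
    obtain ⟨p, hp, rfl⟩ := Finset.mem_image.1 hv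
    exact Finset.mem_Ico.2 (h p hp)
  simpa using Finset.card_le_card this

lemma mul_card_filter_Ico_le {P : ℕ → Prop} [DecidablePred P] {T c : ℕ} (hT : 0 < T)
    (hP : ∀ x, ((Finset.Ico x (x + T)).filter P).card ≤ c) (x l : ℕ) :
    T * ((Finset.Ico x (x + l)).filter P).card ≤ c * (l + T) := by
  have key : ∀ m x, ((Finset.Ico x (x + T * m)).filter P).card ≤ c * m := by
    intro m
    induction m with
    | zero => simp
    | succ m ih =>
      intro x
      rw [← Finset.Ico_union_Ico_eq_Ico (b := x + T * m) (by omega) (by rw [mul_add]; omega),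
        Finset.filter_union]
      refine (Finset.card_union_le _ _).trans ?_
      have h1 := ih x
      have h2 := hP (x + T * m)
      rw [show x + T * (m + 1) = x + T * m + T by ring, mul_add]
      omega
  have h1 : ((Finset.Ico x (x + l)).filter P).card ≤ c * (l / T + 1) := by
    refine le_trans (Finset.card_le_card ?_) (key _ x)
    apply Finset.filter_subset_filter
    apply Finset.Ico_subset_Ico_right
    have := Nat.lt_mul_div_succ l hT
    omega
  calc _ ≤ T * (c * (l / T + 1)) := Nat.mul_le_mul_left _ h1
    _ = c * (T * (l / T) + T) := by ring
    _ ≤ _ := by gcongr; exact Nat.mul_div_le l T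

lemma mul_card_le_of_injOn {ι : Type*} {S : Finset ι} {f : ι → ℕ} (hf : Set.InjOn f S)
    {P : ℕ → Prop} [DecidablePred P] {T c : ℕ} (hT : 0 < T)
    (hP : ∀ x, ((Finset.Ico x (x + T)).filter P).card ≤ c) (hS : ∀ p ∈ S, P (f p)) :
    T * S.card ≤ c * ((intHull S f).card + T) := by
  obtain ⟨x, l, hl⟩ := intHull_eq_Ico S f
  have h1 : S.card ≤ ((Finset.Ico x (x + l)).filter P).card := by
    rw [← hl]
    refine Finset.card_le_card_of_injOn f (fun p hp => ?_) hf
    have hp' : p ∈ S := hp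
    rw [Finset.mem_coe, Finset.mem_filter, mem_intHull]
    exact ⟨⟨⟨p, hp', le_rfl⟩, p, hp', le_rfl⟩, hS p hp'⟩
  have h2 := mul_card_filter_Ico_le hT hP x l
  rw [hl, Nat.card_Ico, Nat.add_sub_cancel_left]
  exact (Nat.mul_le_mul_left _ h1).trans h2

/-- The alternation of blocks of `α` and `β` cells of length `t`, complemented on every other
interval of length `T`. -/
def layerColor (α β t T z : ℕ) : Bool :=
  xor (decide (z / t % (α + β) < α)) (decide (z / T % 2 = 1))

lemma card_filter_cell_lt (α β t : ℕ) (ht : 0 < t) (x : ℕ) :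
    ((Finset.Ico x (x + (α + β) * t)).filter fun z => z / t % (α + β) < α).card = α * t := by
  have hp : Function.Periodic (fun z => z / t % (α + β) < α) ((α + β) * t) := by
    intro z
    simp [Nat.add_mul_div_right _ _ ht]
  rw [Nat.filter_Ico_card_eq_of_periodic _ _ _ hp, Nat.count_eq_card_filter_range]
  have : (Finset.range ((α + β) * t)).filter (fun z => z / t % (α + β) < α) =
      Finset.range (α * t) := by
    ext z
    simp only [Finset.mem_filter, Finset.mem_range, ← Nat.div_lt_iff_lt_mul ht]
    constructor
    · rintro ⟨h1, h2⟩
      rwa [Nat.mod_eq_of_lt h1] at h2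
    · intro h
      have h1 : z / t < α + β := by omega
      exact ⟨h1, by rwa [Nat.mod_eq_of_lt h1]⟩
  rw [this, Finset.card_range]

lemma card_filter_cell_not_lt (α β t : ℕ) (ht : 0 < t) (x : ℕ) :
    ((Finset.Ico x (x + (α + β) * t)).filter fun z => ¬ z / t % (α + β) < α).card = β * t := by
  have h := Finset.card_filter_add_card_filter_not (s := Finset.Ico x (x + (α + β) * t))
    (fun z => z / t % (α + β) < α)
  rw [card_filter_cell_lt α β t ht x, Nat.card_Ico] at h
  have : (α + β) * t = α * t + β * t := by ring
  omega

lemma layerColor_add_half {α β t T : ℕ} (ht : 0 < t) (hT : 0 < T) (h : (α + β) * t ∣ T) (z : ℕ) :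
    layerColor α β t T (z + T) = !layerColor α β t T z := by
  obtain ⟨m, rfl⟩ := h
  have h1 : (z + (α + β) * t * m) / t % (α + β) = z / t % (α + β) := by
    rw [show (α + β) * t * m = ((α + β) * m) * t by ring, Nat.add_mul_div_right _ _ ht,
      Nat.add_mul_mod_self_left]
  unfold layerColor
  rw [h1, Nat.add_div_right _ hT]
  rcases Nat.mod_two_eq_zero_or_one (z / ((α + β) * t * m)) with h2 | h2 <;>
    simp [Nat.add_mod, h2]

lemma card_filter_layerColor {α β t T : ℕ} (ht : 0 < t) (hT : 0 < T) (h : (α + β) * t ∣ T)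
    (col : Bool) (x : ℕ) :
    ((Finset.Ico x (x + 2 * T)).filter fun z => layerColor α β t T z = col).card = T := by
  have e1 : Finset.Ico x (x + 2 * T) = Finset.Ico x (x + T) ∪ Finset.Ico (x + T) (x + T + T) := by
    rw [Finset.Ico_union_Ico_eq_Ico (by omega) (by omega)]
    congr 1; ring
  have e2 : ((Finset.Ico (x + T) (x + T + T)).filter fun z => layerColor α β t T z = col) =
      ((Finset.Ico x (x + T)).filter fun z => ¬ layerColor α β t T z = col).map
        (addRightEmbedding T) := by
    rw [← Finset.map_add_right_Ico x (x + T) T, Finset.filter_map]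
    congr 1
    ext z
    simp only [Finset.mem_filter, Function.comp, addRightEmbedding_apply,
      layerColor_add_half ht hT h]
    cases layerColor α β t T z <;> cases col <;> simp
  rw [e1, Finset.filter_union, Finset.card_union_of_disjoint, e2, Finset.card_map,
    Finset.card_filter_add_card_filter_not]
  · simp
  · exact Finset.disjoint_filter_filter (Finset.Ico_disjoint_Ico_consecutive _ _ _)

/-- `a` and `b` are oppositely ordered on `S`, strictly. -/
def NestedOn {ι : Type*} (S : Finset ι) (a b : ι → ℕ) : Prop :=
  ∀ p ∈ S, ∀ q ∈ S, p ≠ q → (a p < a q ∧ b q < b p) ∨ (a q < a p ∧ b p < b q)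

lemma NestedOn.symm {ι : Type*} {S : Finset ι} {a b : ι → ℕ} (h : NestedOn S a b) :
    NestedOn S b a := fun p hp q hq hpq => (h p hp q hq hpq).symm.imp And.symm And.symm

lemma NestedOn.mono {ι : Type*} {S S' : Finset ι} {a b : ι → ℕ} (h : NestedOn S a b)
    (hS : S' ⊆ S) : NestedOn S' a b := fun p hp q hq => h p (hS hp) q (hS hq)

lemma NestedOn.injOn {ι : Type*} {S : Finset ι} {a b : ι → ℕ} (h : NestedOn S a b) :
    Set.InjOn a S := by
  intro p hp q hq hpq
  by_contra hne
  have := h p hp q hq hne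
  omega

lemma NestedOn.key_lt {ι : Type*} {S : Finset ι} {a b : ι → ℕ} (h : NestedOn S a b)
    {f g : ℕ → ℕ} (hf : Monotone f) (hg : Monotone g) {p q : ι} (hp : p ∈ S) (hq : q ∈ S)
    (hlt : (f (a p) : ℤ) - g (b p) < f (a q) - g (b q)) : a p < a q ∧ b q < b p := by
  have hne : p ≠ q := by rintro rfl; exact lt_irrefl _ hlt
  refine (h p hp q hq hne).resolve_right fun h' => ?_
  have h1 := hf h'.1.le
  have h2 := hg h'.2.le
  omega

lemma NestedOn.key_eq {ι : Type*} {S : Finset ι} {a b : ι → ℕ} (h : NestedOn S a b)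
    {f g : ℕ → ℕ} (hf : Monotone f) (hg : Monotone g) {p q : ι} (hp : p ∈ S) (hq : q ∈ S)
    (heq : (f (a p) : ℤ) - g (b p) = f (a q) - g (b q)) :
    f (a p) = f (a q) ∧ g (b p) = g (b q) := by
  rcases eq_or_ne p q with rfl | hne
  · exact ⟨rfl, rfl⟩
  rcases h p hp q hq hne with h' | h'
  all_goals
    have h1 := hf h'.1.le
    have h2 := hg h'.2.le
    omega

lemma intHull_mono {ι : Type*} {S S' : Finset ι} (f : ι → ℕ) (h : S' ⊆ S) :
    intHull S' f ⊆ intHull S f := by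
  intro z hz
  obtain ⟨⟨p, hp, h1⟩, q, hq, h2⟩ := mem_intHull.1 hz
  exact mem_intHull.2 ⟨⟨p, h hp, h1⟩, q, h hq, h2⟩

/-- The cost of matching within one half period of the first layer and one cell of the second. -/
lemma sum_cell_le {ι : Type*} {S : Finset ι} {a b : ι → ℕ} (hS : NestedOn S a b)
    {α β t T t' T' : ℕ} (hα : 0 < α) (hβ : 0 < β) (ht : 0 < t) (hdvd : (α + β) * t' ∣ T')
    (ha : ∀ p ∈ S, ∀ q ∈ S, a p / T = a q / T) (hb : ∀ p ∈ S, ∀ q ∈ S, b p / t' = b q / t')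
    (hc : ∀ p ∈ S, layerColor α β t T (a p) = layerColor α β t' T' (b p)) :
    ∑ p ∈ S, (if a p / t % (α + β) < α then ((α + β : ℝ) / α) else (α + β) / β) ≤
      (intHull S a).card + (α + β) * t := by
  rcases S.eq_empty_or_nonempty with rfl | ⟨p₀, hp₀⟩
  · simp; positivity
  have hdiv : ∀ z, z / T' = z / t' / (T' / t') := by
    intro z
    obtain ⟨m, rfl⟩ := hdvd
    rw [Nat.div_div_eq_div_mul, Nat.mul_div_cancel']
    exact ⟨(α + β) * m, by ring⟩
  have hcol : ∀ p ∈ S, layerColor α β t T (a p) = layerColor α β t T (a p₀) := by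
    intro p hp
    rw [hc p hp, hc p₀ hp₀, layerColor, layerColor, hdiv, hdiv (b p₀), hb p hp p₀ hp₀]
  have hmin : ∀ p ∈ S, (a p / t % (α + β) < α ↔ a p₀ / t % (α + β) < α) := by
    intro p hp
    have h := hcol p hp
    rw [layerColor, layerColor, ha p hp p₀ hp₀, Bool.xor_left_inj] at h
    simpa using h
  have hs : 0 < (α + β) * t := by positivity
  have hinj := hS.injOn
  by_cases h0 : a p₀ / t % (α + β) < α
  · have h1 := mul_card_le_of_injOn hinj hs (fun x => (card_filter_cell_lt α β t ht x).le)
      (fun p hp => (hmin p hp).2 h0)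
    rw [Finset.sum_congr rfl (fun p hp => if_pos ((hmin p hp).2 h0)), Finset.sum_const,
      nsmul_eq_mul]
    have h2 : (α + β) * S.card ≤ α * ((intHull S a).card + (α + β) * t) := by
      apply Nat.le_of_mul_le_mul_left _ ht
      linarith
    have h3 : ((α + β) * S.card : ℝ) ≤ α * ((intHull S a).card + (α + β) * t) := by
      exact_mod_cast h2
    have hα' : (0 : ℝ) < α := by exact_mod_cast hα
    rw [← mul_div_assoc, div_le_iff₀ hα']
    linarith
  · have h1 := mul_card_le_of_injOn hinj hs (fun x => (card_filter_cell_not_lt α β t ht x).le)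
      (fun p hp => (not_congr (hmin p hp)).2 h0)
    rw [Finset.sum_congr rfl (fun p hp => if_neg ((not_congr (hmin p hp)).2 h0)),
      Finset.sum_const, nsmul_eq_mul]
    have h2 : (α + β) * S.card ≤ β * ((intHull S a).card + (α + β) * t) := by
      apply Nat.le_of_mul_le_mul_left _ ht
      linarith
    have h3 : ((α + β) * S.card : ℝ) ≤ β * ((intHull S a).card + (α + β) * t) := by
      exact_mod_cast h2
    have hβ' : (0 : ℝ) < β := by exact_mod_cast hβ
    rw [← mul_div_assoc, div_le_iff₀ hβ']
    linarith

/-- Within one half period of the first layer, the majority beads that are matched consume twice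
their number in the second layer. -/
lemma sum_majority_le {ι : Type*} {S : Finset ι} {a b : ι → ℕ} (hS : NestedOn S a b)
    {α β t T t' T' : ℕ} (ht' : 0 < t') (hT' : 0 < T') (hdvd : (α + β) * t' ∣ T')
    (ha : ∀ p ∈ S, ∀ q ∈ S, a p / T = a q / T)
    (hc : ∀ p ∈ S, layerColor α β t T (a p) = layerColor α β t' T' (b p)) :
    ∑ p ∈ S, (if a p / t % (α + β) < α then (0 : ℝ) else 2) ≤
      (intHull S b).card + 2 * T' := by
  rcases S.eq_empty_or_nonempty with rfl | ⟨p₀, hp₀⟩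
  · simp; positivity
  set S' := S.filter fun p => ¬ a p / t % (α + β) < α with hS'
  have h1 := mul_card_le_of_injOn (S := S') (f := b)
    ((hS.mono (Finset.filter_subset _ _)).symm.injOn) (T := 2 * T') (by omega)
    (fun x => (card_filter_layerColor ht' hT' hdvd (decide (a p₀ / T % 2 = 1)) x).le) (by
      intro p hp
      obtain ⟨hp, hmaj⟩ := Finset.mem_filter.1 hp
      rw [← hc p hp, layerColor, ha p hp p₀ hp₀]
      simp [hmaj])
  have h2 : 2 * S'.card ≤ (intHull S' b).card + 2 * T' := by
    apply Nat.le_of_mul_le_mul_left _ hT'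
    linarith
  have h3 : (intHull S' b).card ≤ (intHull S b).card :=
    Finset.card_le_card (intHull_mono b (Finset.filter_subset _ _))
  have h4 : 2 * S'.card ≤ (intHull S b).card + 2 * T' := by omega
  have h5 : ∑ p ∈ S, (if a p / t % (α + β) < α then (0 : ℝ) else 2) = 2 * S'.card := by
    rw [Finset.sum_ite, Finset.sum_const_zero, zero_add, Finset.sum_const, nsmul_eq_mul, mul_comm]
  rw [h5]
  exact_mod_cast h4

lemma mul_card_le_of_layers {ι : Type*} {S : Finset ι} {a b : ι → ℕ} (hS : NestedOn S a b)
    {α β t T t' T' X P Y Q : ℕ} (hα : 0 < α) (hβ : 0 < β) (ht : 0 < t) (ht' : 0 < t')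
    (hT' : 0 < T') (hdvd : (α + β) * t' ∣ T')
    (hρ : (α + β : ℝ) / α ≤ (α + β) / β + 2)
    (ha : ∀ p ∈ S, X ≤ a p / T ∧ a p / T < X + P)
    (hb : ∀ p ∈ S, Y ≤ b p / t' ∧ b p / t' < Y + Q)
    (hc : ∀ p ∈ S, layerColor α β t T (a p) = layerColor α β t' T' (b p)) :
    (α + β : ℝ) / α * S.card ≤ (intHull S a).card + (intHull S b).card +
      ((P + Q) * ((α + β) * t) + P * (2 * T')) := by
  have hmT : Monotone fun z => z / T := fun x y h => Nat.div_le_div_right h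
  have hmt : Monotone fun z => z / t' := fun x y h => Nat.div_le_div_right h
  have hm0 : Monotone fun _ : ℕ => 0 := monotone_const
  have h1 := sum_le_card_intHull_add S a (fun p => ((a p / T : ℕ) : ℤ) - (b p / t' : ℕ))
    (Or.inl fun p hp q hq h => (hS.key_lt hmT hmt hp hq h).1)
    (fun p => if a p / t % (α + β) < α then ((α + β : ℝ) / α) else (α + β) / β)
    ((α + β) * t) (by
      intro v _
      refine sum_cell_le (T := T) (T' := T') (hS.mono (Finset.filter_subset _ _)) hα hβ ht hdvd
        ?_ ?_ (fun p hp => hc p (Finset.mem_filter.1 hp).1)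
      all_goals
        intro p hp q hq
        rw [Finset.mem_filter] at hp hq
        have := hS.key_eq hmT hmt hp.1 hq.1 (hp.2.trans hq.2.symm)
      · exact this.1
      · exact this.2)
  have h2 := sum_le_card_intHull_add S b (fun p => ((a p / T : ℕ) : ℤ) - (0 : ℕ))
    (Or.inr fun p hp q hq h => (hS.key_lt hmT hm0 hp hq h).2)
    (fun p => if a p / t % (α + β) < α then (0 : ℝ) else 2) (2 * T') (by
      intro v _
      refine sum_majority_le (T := T) (hS.mono (Finset.filter_subset _ _)) ht' hT' hdvd
        ?_ (fun p hp => hc p (Finset.mem_filter.1 hp).1)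
      intro p hp q hq
      rw [Finset.mem_filter] at hp hq
      exact (hS.key_eq hmT hm0 hp.1 hq.1 (hp.2.trans hq.2.symm)).1)
  have i1 : (S.image fun p => ((a p / T : ℕ) : ℤ) - (b p / t' : ℕ)).card ≤ P + Q := by
    apply card_image_le_of_mem_Ico (x := X - Y - Q)
    intro p hp
    have := ha p hp
    have := hb p hp
    generalize a p / T = u at *
    generalize b p / t' = u' at *
    omega
  have i2 : (S.image fun p => ((a p / T : ℕ) : ℤ) - (0 : ℕ)).card ≤ P := by
    apply card_image_le_of_mem_Ico (x := X)
    intro p hp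
    have := ha p hp
    generalize a p / T = u at *
    omega
  have j1 : ((S.image fun p => ((a p / T : ℕ) : ℤ) - (b p / t' : ℕ)).card : ℝ) * ((α + β) * t) ≤
      (P + Q) * ((α + β) * t) := by
    gcongr
    exact_mod_cast i1
  have j2 : ((S.image fun p => ((a p / T : ℕ) : ℤ) - (0 : ℕ)).card : ℝ) * (2 * T') ≤
      P * (2 * T') := by
    gcongr
  have h3 : (α + β : ℝ) / α * S.card ≤
      ∑ p ∈ S, (if a p / t % (α + β) < α then ((α + β : ℝ) / α) else (α + β) / β) +
      ∑ p ∈ S, (if a p / t % (α + β) < α then (0 : ℝ) else 2) := by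
    rw [← Finset.sum_add_distrib, mul_comm, ← nsmul_eq_mul, ← Finset.sum_const]
    apply Finset.sum_le_sum
    intro p _
    split_ifs
    · simp
    · exact hρ
  linarith

/-- The length of an arc of the necklace `nestedColor`. -/
def arcLength (α β D k : ℕ) : ℕ := 2 * (α + β) * D ^ (2 * k + 1)

/-- The periodic coloring with `k` arcs, whose cells grow and whose half periods shrink with the
index of the arc. -/
def nestedColor (α β D k z : ℕ) : Bool :=
  layerColor α β (D ^ (z / arcLength α β D k % k + 1))
    ((α + β) * D ^ (2 * k - z / arcLength α β D k % k)) z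

lemma div_mem_of_div_mul_eq {z T P I : ℕ} (hP : 0 < P) (h : z / (T * P) = I) :
    P * I ≤ z / T ∧ z / T < P * I + P := by
  rw [← Nat.div_div_eq_div_mul] at h
  subst h
  exact ⟨Nat.mul_div_le _ _, by simpa [mul_add] using Nat.lt_mul_div_succ (z / T) hP⟩

lemma arcLength_pos {α β D : ℕ} (hα : 0 < α) (hD : 0 < D) (k : ℕ) : 0 < arcLength α β D k := by
  unfold arcLength
  positivity

lemma arcLength_eq_halfPeriod_mul (α β D : ℕ) {k i : ℕ} (hi : i < k) :
    arcLength α β D k = ((α + β) * D ^ (2 * k - i)) * (2 * D ^ (i + 1)) := by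
  have : D ^ (2 * k + 1) = D ^ (2 * k - i) * D ^ (i + 1) := by
    rw [← pow_add]; congr 1; omega
  rw [arcLength, this]
  ring

lemma mul_card_le_of_arcs_lt {ι : Type*} {S : Finset ι} {a b : ι → ℕ} (hS : NestedOn S a b)
    {α β D k I J : ℕ} (hα : 0 < α) (hβ : 0 < β) (hD : 0 < D)
    (hρ : (α + β : ℝ) / α ≤ (α + β) / β + 2)
    (ha : ∀ p ∈ S, a p / arcLength α β D k = I) (hb : ∀ p ∈ S, b p / arcLength α β D k = J)
    (hk : 0 < k) (hIJ : I % k < J % k)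
    (hc : ∀ p ∈ S, nestedColor α β D k (a p) = nestedColor α β D k (b p)) :
    (α + β : ℝ) / α * S.card ≤ (intHull S a).card + (intHull S b).card +
      8 * (α + β) ^ 2 * D ^ (2 * k) := by
  have hi := Nat.mod_lt I hk
  have hj := Nat.mod_lt J hk
  set i := I % k with hi'
  set j := J % k with hj'
  have e1 := arcLength_eq_halfPeriod_mul α β D hi
  have e2 : arcLength α β D k = D ^ (j + 1) * (2 * (α + β) * D ^ (2 * k - j)) := by
    rw [arcLength_eq_halfPeriod_mul α β D hj]; ring
  have h := mul_card_le_of_layers hS (α := α) (β := β) (t := D ^ (i + 1))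
    (T := (α + β) * D ^ (2 * k - i)) (t' := D ^ (j + 1)) (T' := (α + β) * D ^ (2 * k - j))
    (P := 2 * D ^ (i + 1)) (Q := 2 * (α + β) * D ^ (2 * k - j))
    (X := 2 * D ^ (i + 1) * I) (Y := 2 * (α + β) * D ^ (2 * k - j) * J)
    hα hβ (by positivity) (by positivity) (by positivity)
    (Nat.mul_dvd_mul_left _ (pow_dvd_pow _ (by omega))) hρ
    (fun p hp => div_mem_of_div_mul_eq (by positivity) (e1 ▸ ha p hp))
    (fun p hp => div_mem_of_div_mul_eq (by positivity) (e2 ▸ hb p hp))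
    (fun p hp => by
      have := hc p hp
      rwa [nestedColor, nestedColor, ha p hp, hb p hp] at this)
  refine h.trans (add_le_add_right ?_ _)
  have b1 : D ^ (i + 1) * D ^ (i + 1) ≤ D ^ (2 * k) := by
    rw [← pow_add]; exact Nat.pow_le_pow_right hD (by omega)
  have b2 : D ^ (2 * k - j) * D ^ (i + 1) ≤ D ^ (2 * k) := by
    rw [← pow_add]; exact Nat.pow_le_pow_right hD (by omega)
  have b3 : (α + β) ≤ (α + β) ^ 2 := Nat.le_self_pow (by norm_num) _
  have b4 : (2 * D ^ (i + 1) + 2 * (α + β) * D ^ (2 * k - j)) * ((α + β) * D ^ (i + 1)) +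
      2 * D ^ (i + 1) * (2 * ((α + β) * D ^ (2 * k - j))) ≤ 8 * (α + β) ^ 2 * D ^ (2 * k) :=
    calc _ = 2 * (α + β) * (D ^ (i + 1) * D ^ (i + 1)) +
        2 * (α + β) ^ 2 * (D ^ (2 * k - j) * D ^ (i + 1)) +
        4 * (α + β) * (D ^ (2 * k - j) * D ^ (i + 1)) := by ring
      _ ≤ 2 * (α + β) ^ 2 * D ^ (2 * k) + 2 * (α + β) ^ 2 * D ^ (2 * k) +
        4 * (α + β) ^ 2 * D ^ (2 * k) := by gcongr
      _ = _ := by ring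
  exact_mod_cast b4

lemma mul_card_le_of_arcs_ne {ι : Type*} {S : Finset ι} {a b : ι → ℕ} (hS : NestedOn S a b)
    {α β D k w m : ℕ} (hα : 0 < α) (hβ : 0 < β) (hD : 0 < D)
    (hρ : (α + β : ℝ) / α ≤ (α + β) / β + 2) (hk : 0 < k)
    (ha : ∀ p ∈ S, w ≤ a p ∧ a p < m)
    (hb : ∀ p ∈ S, m ≤ b p ∧ b p < w + k * arcLength α β D k)
    (hne : ∀ p ∈ S, a p / arcLength α β D k % k ≠ b p / arcLength α β D k % k)
    (hc : ∀ p ∈ S, nestedColor α β D k (a p) = nestedColor α β D k (b p)) :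
    (α + β : ℝ) / α * S.card ≤ k * arcLength α β D k +
      (k + 1) * (8 * (α + β) ^ 2 * D ^ (2 * k)) := by
  set ℓ := arcLength α β D k with hℓ
  have hℓ0 : 0 < ℓ := arcLength_pos hα hD k
  have hmono : Monotone fun z => z / ℓ := fun x y h => Nat.div_le_div_right h
  set g : ι → ℤ := fun p => ((a p / ℓ : ℕ) : ℤ) - (b p / ℓ : ℕ) with hg
  have ha' := sum_card_intHull_fiber_le S a g
    (Or.inl fun p hp q hq h => (hS.key_lt hmono hmono hp hq h).1)
  have hb' := sum_card_intHull_fiber_le S b g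
    (Or.inr fun p hp q hq h => (hS.key_lt hmono hmono hp hq h).2)
  have hcard : (S.image g).card ≤ k + 1 := by
    apply card_image_le_of_mem_Ico (x := -k)
    intro p hp
    have h1 := ha p hp
    have h2 := hb p hp
    have h3 : a p / ℓ ≤ b p / ℓ := hmono (by omega)
    have h4 : w / ℓ ≤ a p / ℓ := hmono (by omega)
    have h5 : b p / ℓ ≤ (w + k * ℓ) / ℓ := hmono (by omega)
    rw [Nat.add_mul_div_right _ _ hℓ0] at h5
    simp only [hg]
    generalize a p / ℓ = u at *
    generalize b p / ℓ = u' at *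
    push_cast
    omega
  have hfib : ∀ v ∈ S.image g, (α + β : ℝ) / α * (S.filter fun p => g p = v).card ≤
      (intHull (S.filter fun p => g p = v) a).card + (intHull (S.filter fun p => g p = v) b).card +
        8 * (α + β) ^ 2 * D ^ (2 * k) := by
    intro v hv
    obtain ⟨q, hq, rfl⟩ := Finset.mem_image.1 hv
    have hS' : NestedOn (S.filter fun p => g p = g q) a b := hS.mono (Finset.filter_subset _ _)
    have hmem : ∀ p ∈ S.filter (fun p => g p = g q), p ∈ S ∧ a p / ℓ = a q / ℓ ∧
        b p / ℓ = b q / ℓ := by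
      intro p hp
      rw [Finset.mem_filter] at hp
      exact ⟨hp.1, hS.key_eq hmono hmono hp.1 hq hp.2⟩
    rcases lt_or_gt_of_ne (hne q hq) with h | h
    · exact mul_card_le_of_arcs_lt hS' hα hβ hD hρ (fun p hp => (hmem p hp).2.1)
        (fun p hp => (hmem p hp).2.2) hk h (fun p hp => hc p (hmem p hp).1)
    · rw [add_comm ((intHull _ a).card : ℝ)]
      exact mul_card_le_of_arcs_lt hS'.symm hα hβ hD hρ (fun p hp => (hmem p hp).2.2)
        (fun p hp => (hmem p hp).2.1) hk h (fun p hp => (hc p (hmem p hp).1).symm)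
  have htot : (intHull S a).card + (intHull S b).card ≤ k * ℓ := by
    rcases S.eq_empty_or_nonempty with rfl | ⟨p, hp⟩
    · simp [intHull]
    have h1 := Finset.card_le_card (intHull_subset_Ico ha)
    have h2 := Finset.card_le_card (intHull_subset_Ico hb)
    rw [Nat.card_Ico] at h1 h2
    have := ha p hp
    have := hb p hp
    omega
  have hsum := Finset.sum_le_sum hfib
  rw [← Finset.mul_sum, ← Nat.cast_sum,
    ← Finset.card_eq_sum_card_fiberwise (fun p hp => Finset.mem_image_of_mem g hp),
    Finset.sum_add_distrib, Finset.sum_add_distrib, Finset.sum_const, nsmul_eq_mul,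
    ← Nat.cast_sum, ← Nat.cast_sum] at hsum
  have h1 : ((S.image g).card : ℝ) * (8 * (α + β) ^ 2 * D ^ (2 * k)) ≤
      (k + 1) * (8 * (α + β) ^ 2 * D ^ (2 * k)) := by
    gcongr
    exact_mod_cast hcard
  have h2 : ((∑ v ∈ S.image g, (intHull (S.filter fun p => g p = v) a).card : ℕ) : ℝ) +
      (∑ v ∈ S.image g, (intHull (S.filter fun p => g p = v) b).card : ℕ) ≤ k * ℓ := by
    exact_mod_cast (add_le_add ha' hb').trans htot
  linarith

/-- Only few nested pairs join two arcs with the same index. -/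
lemma card_le_of_arcs_eq {ι : Type*} {S : Finset ι} {a b : ι → ℕ} (hS : NestedOn S a b)
    {ℓ k w : ℕ} (hℓ : 0 < ℓ)
    (hab : ∀ p ∈ S, w ≤ a p ∧ a p < b p ∧ b p < w + k * ℓ)
    (heq : ∀ p ∈ S, a p / ℓ % k = b p / ℓ % k) : S.card ≤ 2 * ℓ := by
  have hmono : Monotone fun z => z / ℓ := fun x y h => Nat.div_le_div_right h
  have key : ∀ S' ⊆ S, (∀ p ∈ S', ∀ q ∈ S', a p / ℓ = a q / ℓ) → S'.card ≤ ℓ := by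
    intro S' hS' h
    rcases S'.eq_empty_or_nonempty with rfl | ⟨q, hq⟩
    · simp
    calc S'.card ≤ (Finset.Ico (ℓ * (a q / ℓ)) (ℓ * (a q / ℓ) + ℓ)).card := by
          refine Finset.card_le_card_of_injOn a (fun p hp => ?_) (hS.mono hS').injOn
          rw [Finset.mem_coe, Finset.mem_Ico, ← h p hp q hq]
          exact ⟨Nat.mul_div_le _ _, by simpa [mul_add] using Nat.lt_mul_div_succ (a p) hℓ⟩
      _ = ℓ := by simp
  rw [← Finset.card_filter_add_card_filter_not (fun p => a p / ℓ = b p / ℓ), two_mul]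
  refine add_le_add (key _ (Finset.filter_subset _ _) ?_) (key _ (Finset.filter_subset _ _) ?_)
  · intro p hp q hq
    rw [Finset.mem_filter] at hp hq
    rcases eq_or_ne p q with rfl | hne
    · rfl
    have h1 := (hab p hp.1).2.1
    have h2 := (hab q hq.1).2.1
    rcases hS p hp.1 q hq.1 hne with h | h
    · exact le_antisymm (hmono h.1.le) (hq.2.trans_le ((hmono h.2.le).trans hp.2.ge))
    · exact le_antisymm (hp.2.trans_le ((hmono h.2.le).trans hq.2.ge)) (hmono h.1.le)
  · suffices h : ∀ p ∈ S.filter (fun p => ¬ a p / ℓ = b p / ℓ), a p / ℓ = w / ℓ from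
      fun p hp q hq => (h p hp).trans (h q hq).symm
    intro p hp
    rw [Finset.mem_filter] at hp
    obtain ⟨h1, h2, h3⟩ := hab p hp.1
    have h4 : w / ℓ ≤ a p / ℓ := hmono h1
    have h5 : a p / ℓ ≤ b p / ℓ := hmono h2.le
    have h6 : b p / ℓ ≤ (w + k * ℓ) / ℓ := hmono h3.le
    rw [Nat.add_mul_div_right _ _ hℓ] at h6
    have h7 : k ∣ b p / ℓ - a p / ℓ := (Nat.modEq_iff_dvd' h5).1 (heq p hp.1)
    have h8 := Nat.le_of_dvd (by omega) h7
    omega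

lemma mul_card_le_of_nested {ι : Type*} {S : Finset ι} {a b : ι → ℕ} (hS : NestedOn S a b)
    {α β D k w m : ℕ} (hα : 0 < α) (hβ : 0 < β) (hD : 0 < D)
    (hρ : (α + β : ℝ) / α ≤ (α + β) / β + 2) (hk : 0 < k)
    (ha : ∀ p ∈ S, w ≤ a p ∧ a p < m)
    (hb : ∀ p ∈ S, m ≤ b p ∧ b p < w + k * arcLength α β D k)
    (hc : ∀ p ∈ S, nestedColor α β D k (a p) = nestedColor α β D k (b p)) :
    (α + β : ℝ) / α * S.card ≤ k * arcLength α β D k +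
      (k + 1) * (8 * (α + β) ^ 2 * D ^ (2 * k)) + (α + β) / α * (2 * arcLength α β D k) := by
  set ℓ := arcLength α β D k with hℓ
  have h1 := card_le_of_arcs_eq (S := S.filter fun p => a p / ℓ % k = b p / ℓ % k) (w := w)
    (hS.mono (Finset.filter_subset _ _)) (arcLength_pos hα hD k) (fun p hp => by
      have hp' := (Finset.mem_filter.1 hp).1
      exact ⟨(ha p hp').1, (ha p hp').2.trans_le (hb p hp').1, (hb p hp').2⟩)
    (fun p hp => (Finset.mem_filter.1 hp).2)
  have h2 := mul_card_le_of_arcs_ne (S := S.filter fun p => ¬ a p / ℓ % k = b p / ℓ % k)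
    (hS.mono (Finset.filter_subset _ _)) hα hβ hD hρ hk
    (fun p hp => ha p (Finset.mem_filter.1 hp).1) (fun p hp => hb p (Finset.mem_filter.1 hp).1)
    (fun p hp => (Finset.mem_filter.1 hp).2) (fun p hp => hc p (Finset.mem_filter.1 hp).1)
  rw [← Finset.card_filter_add_card_filter_not (s := S) (fun p => a p / ℓ % k = b p / ℓ % k)]
  have h3 : (α + β : ℝ) / α * (S.filter fun p => a p / ℓ % k = b p / ℓ % k).card ≤
      (α + β) / α * (2 * ℓ) := by
    gcongr
    exact_mod_cast h1
  push_cast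
  rw [mul_add]
  linarith

lemma layerColor_periodic {α β t T : ℕ} (ht : 0 < t) (hT : 0 < T) (h : (α + β) * t ∣ T) :
    Function.Periodic (layerColor α β t T) (2 * T) := by
  intro z
  rw [two_mul, ← add_assoc, layerColor_add_half ht hT h, layerColor_add_half ht hT h, Bool.not_not]

lemma card_filter_layerColor_mul {α β t T : ℕ} (ht : 0 < t) (hT : 0 < T) (h : (α + β) * t ∣ T)
    (col : Bool) (x m : ℕ) :
    ((Finset.Ico x (x + 2 * T * m)).filter fun z => layerColor α β t T z = col).card = T * m := by
  induction m with
  | zero => simp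
  | succ m ih =>
    rw [← Finset.Ico_union_Ico_eq_Ico (b := x + 2 * T * m) (by omega)
      (by rw [mul_add]; omega), Finset.filter_union, Finset.card_union_of_disjoint
      (Finset.disjoint_filter_filter (Finset.Ico_disjoint_Ico_consecutive _ _ _)), ih,
      show x + 2 * T * (m + 1) = x + 2 * T * m + 2 * T by ring, card_filter_layerColor ht hT h]
    ring

lemma nestedColor_periodic {α β D k : ℕ} (hα : 0 < α) (hD : 0 < D) (hk : 0 < k) :
    Function.Periodic (nestedColor α β D k) (k * arcLength α β D k) := by
  intro z
  have hi := Nat.mod_lt (z / arcLength α β D k) hk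
  rw [nestedColor, nestedColor, Nat.add_mul_div_right _ _ (arcLength_pos hα hD k),
    Nat.add_mod_right]
  set i := z / arcLength α β D k % k
  have hp := (layerColor_periodic (α := α) (β := β) (t := D ^ (i + 1))
    (T := (α + β) * D ^ (2 * k - i)) (by positivity) (by positivity)
    (Nat.mul_dvd_mul_left _ (pow_dvd_pow _ (by omega)))).nat_mul (k * D ^ (i + 1))
  have e : k * arcLength α β D k =
      ((k * D ^ (i + 1) : ℕ) : ℕ) * (2 * ((α + β) * D ^ (2 * k - i))) := by
    rw [arcLength_eq_halfPeriod_mul α β D hi]; ring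
  rw [e]
  exact hp z

lemma card_filter_nestedColor {α β D k : ℕ} (hα : 0 < α) (hD : 0 < D) (hk : 0 < k) (m : ℕ) :
    2 * ((Finset.range (arcLength α β D k * m)).filter fun z => nestedColor α β D k z = true).card =
      arcLength α β D k * m := by
  have hℓ := arcLength_pos (β := β) hα hD k
  simp only [Finset.range_eq_Ico]
  induction m with
  | zero => simp
  | succ m ih =>
    rw [← Finset.Ico_union_Ico_eq_Ico (b := arcLength α β D k * m) (by omega)
      (by rw [mul_add]; omega), Finset.filter_union, Finset.card_union_of_disjoint
      (Finset.disjoint_filter_filter (Finset.Ico_disjoint_Ico_consecutive _ _ _)), mul_add, ih]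
    have hi := Nat.mod_lt m hk
    have h := card_filter_layerColor_mul (α := α) (β := β) (t := D ^ (m % k + 1))
      (T := (α + β) * D ^ (2 * k - m % k)) (by positivity) (by positivity)
      (Nat.mul_dvd_mul_left _ (pow_dvd_pow _ (by omega))) true
      (arcLength α β D k * m) (D ^ (m % k + 1))
    have e : 2 * ((α + β) * D ^ (2 * k - m % k)) * D ^ (m % k + 1) = arcLength α β D k := by
      rw [arcLength_eq_halfPeriod_mul α β D hi]; ring
    rw [e] at h
    rw [mul_add, mul_one, Finset.filter_congr (q := fun z =>
      layerColor α β (D ^ (m % k + 1)) ((α + β) * D ^ (2 * k - m % k)) z = true), h]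
    · rw [← mul_assoc, e]
    · intro z hz
      rw [Finset.mem_Ico] at hz
      have : z / arcLength α β D k = m := by
        rw [Nat.div_eq_iff hℓ]
        constructor
        · linarith [mul_comm (arcLength α β D k) m]
        · have := mul_comm (arcLength α β D k) m
          omega
      rw [nestedColor, this]

lemma nestedColor_succ {α β D k z : ℕ} (hk : 0 < k) (hz : ¬ D ∣ z + 1) :
    nestedColor α β D k (z + 1) = nestedColor α β D k z := by
  have key : ∀ M, D ∣ M → (z + 1) / M = z / M :=
    fun M hM => Nat.succ_div_of_not_dvd fun h => hz (hM.trans h)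
  have hi := Nat.mod_lt (z / arcLength α β D k) hk
  rw [nestedColor, nestedColor, key (arcLength α β D k)
    (Dvd.dvd.mul_left (dvd_pow_self D (by omega)) _)]
  unfold layerColor
  rw [key _ (dvd_pow_self D (by omega)), key _ (Dvd.dvd.mul_left (dvd_pow_self D (by omega)) _)]

lemma fin_sub_val {N : ℕ} (x a : Fin N) :
    (x - a).val = if a.val ≤ x.val then x.val - a.val else N + x.val - a.val := by
  rw [Fin.sub_def]
  have := x.isLt
  have := a.isLt
  split_ifs
  · rw [show N - a.val + x.val = (x.val - a.val) + N by omega]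
    simp only [Nat.add_mod_right]
    exact Nat.mod_eq_of_lt (by omega)
  · simp only
    rw [Nat.mod_eq_of_lt (by omega)]
    omega

lemma strictBtw_iff {N : ℕ} (s a x b : Fin N) : strictBtw a x b ↔
    ((a - s).val < (x - s).val ∧ (x - s).val < (b - s).val) ∨
    ((x - s).val < (b - s).val ∧ (b - s).val < (a - s).val) ∨
    ((b - s).val < (a - s).val ∧ (a - s).val < (x - s).val) := by
  have := x.isLt
  have := a.isLt
  have := b.isLt
  have := s.isLt
  unfold strictBtw
  simp only [fin_sub_val]
  split_ifs <;> omega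

lemma fin_sub_val_inj {N : ℕ} {s x y : Fin N} (h : (x - s).val = (y - s).val) : x = y := by
  have := x.isLt
  have := y.isLt
  have := s.isLt
  simp only [fin_sub_val] at h
  ext
  split_ifs at h <;> omega

lemma RespectsSecant.min_lt_and_le_max {N : ℕ} {M : Finset (Fin N × Fin N)} {s : Fin N} {m : ℕ}
    (hs : RespectsSecant M s m) {p : Fin N × Fin N} (hp : p ∈ M) :
    min (p.1 - s).val (p.2 - s).val < m ∧ m ≤ max (p.1 - s).val (p.2 - s).val := by
  rcases hs.2.2 p hp with ⟨h1, h2⟩ | ⟨h1, h2⟩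
  all_goals
    simp only [InArc] at h1 h2
    omega

lemma nestedOn_of_crossFree {N : ℕ} {M : Finset (Fin N × Fin N)} (hM : IsMatching M)
    (hcf : CrossFree M) {s : Fin N} {m : ℕ} (hs : RespectsSecant M s m) :
    NestedOn M (fun p => s.val + min (p.1 - s).val (p.2 - s).val)
      (fun p => s.val + max (p.1 - s).val (p.2 - s).val) := by
  intro p hp q hq hpq
  obtain ⟨h1, h2, h3, h4⟩ := hM.2 p hp q hq hpq
  have n1 : (p.1 - s).val ≠ (q.1 - s).val := fun h => h1 (fin_sub_val_inj h)
  have n2 : (p.1 - s).val ≠ (q.2 - s).val := fun h => h2 (fin_sub_val_inj h)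
  have n3 : (p.2 - s).val ≠ (q.1 - s).val := fun h => h3 (fin_sub_val_inj h)
  have n4 : (p.2 - s).val ≠ (q.2 - s).val := fun h => h4 (fin_sub_val_inj h)
  have hc := hcf p hp q hq
  have hp' := hs.min_lt_and_le_max hp
  have hq' := hs.min_lt_and_le_max hq
  simp only [Crosses, strictBtw_iff s] at hc
  simp only
  generalize (p.1 - s).val = x at *
  generalize (p.2 - s).val = y at *
  generalize (q.1 - s).val = u at *
  generalize (q.2 - s).val = v at *
  omega

lemma card_filter_fin (N : ℕ) (P : ℕ → Prop) [DecidablePred P] :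
    (Finset.univ.filter fun i : Fin N => P i.val).card = ((Finset.range N).filter P).card := by
  rw [Finset.card_filter, Finset.card_filter,
    Fin.sum_univ_eq_sum_range (fun i => if P i then 1 else 0)]

lemma monoCount_nestedColor_le {α β D k N : ℕ} (hα : 0 < α) (hD : 0 < D) (hk : 0 < k)
    (hN : N = k * arcLength α β D k) :
    monoCount (fun i : Fin N => nestedColor α β D k i.val) ≤ N / D := by
  rw [← Nat.card_multiples N D, ← card_filter_fin N (fun z => D ∣ z + 1)]
  unfold monoCount
  apply Finset.card_le_card
  intro i hi
  simp only [Finset.mem_filter, Finset.mem_univ, true_and] at hi ⊢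
  by_contra hd
  apply hi
  have hper : Function.Periodic (nestedColor α β D k) N :=
    hN ▸ nestedColor_periodic hα hD hk
  rw [hper.map_mod_nat, nestedColor_succ hk hd]

lemma mul_card_le_of_proper {α β D k N : ℕ} (hα : 0 < α) (hβ : 0 < β) (hD : 0 < D)
    (hρ : (α + β : ℝ) / α ≤ (α + β) / β + 2) (hk : 0 < k) (hN : N = k * arcLength α β D k)
    {M : Finset (Fin N × Fin N)} (hM : IsMatching M) (hp : IsProper M)
    (hh : Homogeneous (fun i : Fin N => nestedColor α β D k i.val) M) :
    (α + β : ℝ) / α * M.card ≤ k * arcLength α β D k +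
      (k + 1) * (8 * (α + β) ^ 2 * D ^ (2 * k)) + (α + β) / α * (2 * arcLength α β D k) := by
  obtain ⟨hcf, s, m, hs⟩ := hp
  have hper : Function.Periodic (nestedColor α β D k) N :=
    hN ▸ nestedColor_periodic hα hD hk
  have hcol : ∀ x : Fin N,
      nestedColor α β D k (s.val + (x - s).val) = nestedColor α β D k x.val := by
    intro x
    rw [fin_sub_val]
    split_ifs with h
    · rw [Nat.add_sub_cancel' h]
    · rw [show s.val + (N + x.val - s.val) = x.val + N by omega, hper]
  refine mul_card_le_of_nested (nestedOn_of_crossFree hM hcf hs) hα hβ hD hρ hk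
    (w := s.val) (m := s.val + m) ?_ ?_ ?_
  · intro p hp
    have := hs.min_lt_and_le_max hp
    omega
  · intro p hp
    have h := hs.min_lt_and_le_max hp
    have h1 := (p.1 - s).isLt
    have h2 := (p.2 - s).isLt
    have h3 := max_lt h1 h2
    rw [← hN]
    omega
  · intro p hp
    have h := hh p hp
    simp only at h
    rcases le_total (p.1 - s).val (p.2 - s).val with h' | h'
    · simp only [min_eq_left h', max_eq_right h', hcol, h]
    · simp only [min_eq_right h', max_eq_left h', hcol, h]

/-- Positive integers whose ratio is slightly below `1 + √2`. -/
lemma exists_ratio_near (ε : ℝ) (hε : 0 < ε) : ∃ α β : ℕ, 0 < α ∧ 0 < β ∧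
    (α + β : ℝ) / α ≤ (α + β) / β + 2 ∧ 2 ≤ (α + β : ℝ) / α ∧
    2 ≤ (2 - Real.sqrt 2 + ε) * ((α + β : ℝ) / α) := by
  have hsq : Real.sqrt 2 ^ 2 = 2 := Real.sq_sqrt (by norm_num)
  have h1 : 1 < Real.sqrt 2 := by nlinarith [Real.sqrt_nonneg 2]
  have h2 : Real.sqrt 2 < 2 := by nlinarith
  have hpos : 0 < 2 - Real.sqrt 2 + ε := by linarith
  have hlt : max 1 (2 / (2 - Real.sqrt 2 + ε) - 1) < 1 + Real.sqrt 2 := by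
    rw [max_lt_iff]
    refine ⟨by linarith, ?_⟩
    rw [sub_lt_iff_lt_add, div_lt_iff₀ hpos]
    nlinarith
  obtain ⟨q, hq1, hq2⟩ := exists_rat_btwn hlt
  rw [max_lt_iff, sub_lt_iff_lt_add, div_lt_iff₀ hpos] at hq1
  obtain ⟨hq0, hq1⟩ := hq1
  have hq0' : 0 < q := by
    have : (0 : ℝ) < q := by linarith
    exact_mod_cast this
  have hnum : 0 < q.num := Rat.num_pos.2 hq0'
  obtain ⟨β, hβ⟩ := Int.eq_ofNat_of_zero_le hnum.le
  have hα : (0 : ℝ) < q.den := by exact_mod_cast q.pos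
  have hβ0 : 0 < β := by omega
  have hβ' : (0 : ℝ) < β := by exact_mod_cast hβ0
  have hqe : (q : ℝ) = β / q.den := by
    rw [Rat.cast_def, hβ]; simp
  have e1 : (q.den + β : ℝ) / q.den = 1 + q := by rw [hqe]; field_simp
  have e2 : (q.den + β : ℝ) / β = 1 + 1 / q := by rw [hqe]; field_simp; ring
  refine ⟨q.den, β, q.pos, hβ0, ?_, ?_, ?_⟩
  · rw [e1, e2]
    have : (q : ℝ) - 2 ≤ 1 / q := by
      rw [le_div_iff₀ (by linarith)]
      nlinarith
    linarith
  · rw [e1]; linarith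
  · rw [e1]; linarith

/-- for every ε > 0 and N₀ there is a balanced necklace on
N = 2n ≥ N₀ beads with mono(L) ≤ ε·N such that every proper homogeneous
matching has size at most (2 − √2 + ε)·n. -/
theorem stmt7 (ε : ℝ) (hε : 0 < ε) (N₀ : ℕ) :
    ∃ n : ℕ, N₀ ≤ 2 * n ∧ ∃ c : Fin (2 * n) → Bool,
      redCount c = n ∧
      (monoCount c : ℝ) ≤ ε * (2 * n) ∧
      ∀ M : Finset (Fin (2 * n) × Fin (2 * n)),
        IsMatching M → IsProper M → Homogeneous c M →
        (M.card : ℝ) ≤ (2 - Real.sqrt 2 + ε) * n := by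
  obtain ⟨α, β, hα, hβ, hρ, hC2, hC⟩ := exists_ratio_near (ε / 2) (by linarith)
  obtain ⟨k, hk⟩ := exists_nat_gt (16 / ε)
  obtain ⟨D, hD⟩ := exists_nat_gt (max (N₀ : ℝ) (32 * (α + β) / ε))
  rw [max_lt_iff, div_lt_iff₀ hε] at hD
  rw [div_lt_iff₀ hε] at hk
  have hk0' : (0 : ℝ) < k := by by_contra h; nlinarith
  have hk0 : 0 < k := by exact_mod_cast hk0'
  have hα' : (1 : ℝ) ≤ α := by exact_mod_cast hα
  have hβ' : (1 : ℝ) ≤ β := by exact_mod_cast hβ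
  have hD0' : (0 : ℝ) < D := by by_contra h; nlinarith
  have hD0 : 0 < D := by exact_mod_cast hD0'
  have h2n : 2 * (k * ((α + β) * D ^ (2 * k + 1))) = k * arcLength α β D k := by
    rw [arcLength]; ring
  set n := k * ((α + β) * D ^ (2 * k + 1)) with hn
  have h2n' : (2 * n : ℝ) = k * arcLength α β D k := by exact_mod_cast h2n
  refine ⟨n, ?_, fun i => nestedColor α β D k i.val, ?_, ?_, ?_⟩
  · have h1 : N₀ < D := by exact_mod_cast hD.1
    have h2 : D ≤ D ^ (2 * k + 1) := Nat.le_self_pow (by omega) D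
    have h3 : D ^ (2 * k + 1) ≤ n := by
      rw [hn, ← mul_assoc]
      exact Nat.le_mul_of_pos_left _ (by positivity)
    omega
  · have h := card_filter_nestedColor (β := β) hα hD0 hk0 k
    rw [mul_comm (arcLength α β D k), ← h2n] at h
    rw [redCount, card_filter_fin (2 * n) (fun z => nestedColor α β D k z = true)]
    omega
  · have h : (monoCount fun i : Fin (2 * n) => nestedColor α β D k i.val : ℝ) ≤
        ((2 * n / D : ℕ) : ℝ) := by
      exact_mod_cast monoCount_nestedColor_le hα hD0 hk0 h2n
    refine (h.trans Nat.cast_div_le).trans ?_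
    rw [div_le_iff₀ hD0']
    have : 1 ≤ ε * D := by nlinarith
    push_cast
    nlinarith [Nat.cast_nonneg (α := ℝ) n]
  · intro M hM hp hh
    have h := mul_card_le_of_proper hα hβ hD0 hρ hk0 h2n hM hp hh
    set C : ℝ := (α + β) / α with hCdef
    have hℓ : (0 : ℝ) ≤ arcLength α β D k := Nat.cast_nonneg _
    have hn0 : (0 : ℝ) ≤ n := Nat.cast_nonneg _
    have b1 : C * (2 * (arcLength α β D k : ℝ)) ≤ C * (ε / 4 * n) := by
      refine mul_le_mul_of_nonneg_left ?_ (by linarith)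
      have := mul_nonneg hℓ (sub_nonneg.2 hk.le)
      nlinarith
    have b2 : ((k : ℝ) + 1) * (8 * (α + β) ^ 2 * D ^ (2 * k)) ≤ 2 * (ε / 4 * n) := by
      have hk1 : (1 : ℝ) ≤ k := by exact_mod_cast hk0
      have hnr : (n : ℝ) = k * (α + β) * D ^ (2 * k) * D := by
        rw [hn]; push_cast; ring
      rw [hnr]
      have hX : (0 : ℝ) ≤ k * (α + β) * D ^ (2 * k) := by positivity
      calc ((k : ℝ) + 1) * (8 * (α + β) ^ 2 * D ^ (2 * k))
          ≤ ((k : ℝ) + k) * (8 * (α + β) ^ 2 * D ^ (2 * k)) := by gcongr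
        _ = ((k : ℝ) * (α + β) * D ^ (2 * k)) * (32 * (α + β)) / 2 := by ring
        _ ≤ ((k : ℝ) * (α + β) * D ^ (2 * k)) * (D * ε) / 2 := by
            have := mul_le_mul_of_nonneg_left hD.2.le hX
            linarith
        _ = _ := by ring
    have b3 : 2 * (ε / 4 * n) ≤ C * (ε / 4 * n) := by gcongr
    have b4 : (2 : ℝ) * n ≤ (2 - Real.sqrt 2 + ε / 2) * C * n := by gcongr
    have hCpos : 0 < C := by linarith
    refine le_of_mul_le_mul_left ?_ hCpos
    calc C * (M.card : ℝ) ≤ (2 - Real.sqrt 2 + ε / 2) * C * n + C * (ε / 4 * n) +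
          C * (ε / 4 * n) := by linarith
      _ = _ := by ring
end

section
/- Let a necklace on N beads be partitioned, in cyclic order, into s ≥ 3 consecutive arcs L_1, …, L_s, and let M be a cross-free matching that respects a secant whose two cut points are assigned to arcs L_p and L_r with p ≠ r. Define a graph G on vertex set {1, …, s} ∖ {p, r} by joining g and h (g ≠ h) whenever some pair of M with neither bead in L_p ∪ L_r has one bead in L_g and the other in L_h (such a pair (g,h) is called bonded). Then G contains no cycle; in particular, G has at most (s − 2) − 1 = s − 3 edges, so the number of bonded pairs is at most s − 3. -/
namespace SimpleGraph

/-- A bipartite graph whose sides are `f < m` and `m ≤ f`, drawn without crossings, is a forest. -/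
theorem isAcyclic_of_noncrossing {V : Type*} {G : SimpleGraph V} (f : V → ℕ) (m : ℕ)
    (hf : Function.Injective f)
    (hside : ∀ ⦃g h⦄, G.Adj g h → f g < m → m ≤ f h)
    (hside' : ∀ ⦃g h⦄, G.Adj g h → m ≤ f g → f h < m)
    (hnest : ∀ ⦃g h g' h'⦄, G.Adj g h → G.Adj g' h' → f g < m → f g' < m → f g < f g' →
      f h' ≤ f h) :
    G.IsAcyclic := by
  intro v w hw
  have two_nbrs : ∀ u ∈ w.support, ∃ a b, f a < f b ∧ a ∈ w.support ∧ b ∈ w.support ∧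
      G.Adj u a ∧ G.Adj u b := by
    intro u hu
    obtain ⟨a, b, hab, hset⟩ :=
      Set.ncard_eq_two.mp (hw.ncard_neighborSet_toSubgraph_eq_two hu)
    have mem : ∀ x, x ∈ w.toSubgraph.neighborSet u → x ∈ w.support ∧ G.Adj u x := fun x hx =>
      ⟨w.mem_verts_toSubgraph.mp (w.toSubgraph.edge_vert hx.symm), w.toSubgraph.adj_sub hx⟩
    have ha := mem a (by simp [hset])
    have hb := mem b (by simp [hset])
    rcases lt_or_gt_of_ne (hf.ne hab) with hlt | hlt
    · exact ⟨a, b, hlt, ha.1, hb.1, ha.2, hb.2⟩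
    · exact ⟨b, a, hlt, hb.1, ha.1, hb.2, ha.2⟩
  obtain ⟨g₀, hg₀, hmin⟩ : ∃ g ∈ w.support, ∀ x ∈ w.support, f g ≤ f x := by
    classical
    obtain ⟨g, hg, hmin⟩ := w.support.toFinset.exists_min_image f ⟨v, by simp⟩
    exact ⟨g, by simpa using hg, fun x hx => hmin x (by simpa using hx)⟩
  obtain ⟨h₁, h₂, hlt, -, hh₂, hadj₁, hadj₂⟩ := two_nbrs g₀ hg₀
  have hg₀m : f g₀ < m := by
    by_contra! hge
    exact absurd (hside' hadj₂ hge) (by have := hmin h₂ hh₂; omega)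
  obtain ⟨g₁, hg₁, hne, hadj⟩ : ∃ g₁ ∈ w.support, g₁ ≠ g₀ ∧ G.Adj g₁ h₂ := by
    obtain ⟨a, b, hab, ha, hb, hadja, hadjb⟩ := two_nbrs h₂ hh₂
    by_cases h : a = g₀
    · exact ⟨b, hb, fun hb' => by simp [h, hb'] at hab, hadjb.symm⟩
    · exact ⟨a, ha, h, hadja.symm⟩
  have := hnest hadj₁ hadj hg₀m (hside' hadj.symm (hside hadj₂ hg₀m))
    (lt_of_le_of_ne (hmin g₁ hg₁) (hf.ne hne.symm))
  omega

theorem IsAcyclic.ncard_edgeSet_lt_card {V : Type*} [Finite V] [Nonempty V]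
    {G : SimpleGraph V} (hG : G.IsAcyclic) : G.edgeSet.ncard < Nat.card V := by
  classical
  have := Fintype.ofFinite V
  obtain ⟨T, hle, -, hT⟩ :=
    (connected_top (V := V)).exists_isTree_le_of_le_of_isAcyclic le_top hG
  have hcard := hT.card_edgeFinset
  have := Set.ncard_le_ncard (edgeSet_mono hle) (Set.toFinite _)
  rw [← coe_edgeFinset T, Set.ncard_coe_finset] at this
  rw [Nat.card_eq_fintype_card]
  omega

theorem IsAcyclic.ncard_edgeSet_lt_ncard_of_support_subset {V : Type*} [Finite V]
    {G : SimpleGraph V} (hG : G.IsAcyclic) {S : Set V} (hS : S.Nonempty) (h : G.support ⊆ S) :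
    G.edgeSet.ncard < S.ncard := by
  classical
  have := Fintype.ofFinite V
  have := hS.to_subtype
  have hlt := (hG.induce S).ncard_edgeSet_lt_card
  rw [← coe_edgeFinset, Set.ncard_coe_finset, card_edgeFinset_induce_of_support_subset h] at hlt
  rwa [← coe_edgeFinset, Set.ncard_coe_finset]

end SimpleGraph

theorem Fin.val_sub_eq_ite {N : ℕ} (x y : Fin N) :
    (x - y).val = if y.val ≤ x.val then x.val - y.val else x.val + N - y.val := by
  split_ifs with h
  · exact Fin.sub_val_of_le h
  · rw [Fin.coe_sub_iff_lt.mpr (by simpa using h)]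
    omega

theorem Fin.pred_mod_eq_ite {N : ℕ} (k : Fin N) :
    (k.val + N - 1) % N = if k.val = 0 then N - 1 else k.val - 1 := by
  have := k.isLt
  split_ifs with h
  · rw [h, Nat.mod_eq_of_lt] <;> omega
  · rw [show k.val + N - 1 = k.val - 1 + N by omega, Nat.add_mod_right, Nat.mod_eq_of_lt]
    omega

theorem Fin.eq_of_val_sub_eq {N : ℕ} {k x y : Fin N} (h : (x - k).val = (y - k).val) : x = y := by
  have := k.isLt
  have := x.isLt
  have := y.isLt
  simp only [Fin.val_sub_eq_ite] at h
  exact Fin.ext (by split_ifs at h <;> omega)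

/-- An element outside a fibre of a monotone map does not separate points of that fibre. -/
theorem val_le_iff_of_fibre {N s : ℕ} {arcIdx : Fin N → Fin s}
    (hmono : ∀ x y : Fin N, x.val ≤ y.val → arcIdx x ≤ arcIdx y) {x x' e : Fin N}
    (hxx' : arcIdx x = arcIdx x') (he : arcIdx x ≠ arcIdx e) :
    x.val ≤ e.val ↔ x'.val ≤ e.val := by
  have key : ∀ {a b : Fin N}, arcIdx a = arcIdx b → arcIdx a ≠ arcIdx e → a.val ≤ e.val →
      b.val ≤ e.val := by
    intro a b hab hne hae
    by_contra! hlt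
    exact hne (le_antisymm (hmono _ _ hae) (hab ▸ hmono _ _ hlt.le))
  exact ⟨key hxx' he, key hxx'.symm (hxx' ▸ he)⟩

/-- Beads of an arc containing no cut point lie on the same side of the secant. -/
theorem inArc_iff_of_fibre {N s : ℕ} (hN : 0 < N) {arcIdx : Fin N → Fin s}
    (hmono : ∀ x y : Fin N, x.val ≤ y.val → arcIdx x ≤ arcIdx y) {k : Fin N} {m : ℕ}
    (hm : m < N) {x x' : Fin N} (hxx' : arcIdx x = arcIdx x')
    (hk : arcIdx x ≠ arcIdx ⟨(k.val + N - 1) % N, Nat.mod_lt _ hN⟩)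
    (hkm : arcIdx x ≠ arcIdx ⟨(k.val + m + N - 1) % N, Nat.mod_lt _ hN⟩) :
    InArc k m x ↔ InArc k m x' := by
  have h₁ := val_le_iff_of_fibre hmono hxx' hk
  have h₂ := val_le_iff_of_fibre hmono hxx' hkm
  simp only [InArc, Fin.val_sub_eq_ite] at *
  have := k.isLt
  have := x.isLt
  have := x'.isLt
  have e₂ : (k.val + m + N - 1) % N = if k.val + m = 0 then N - 1 else
      if k.val + m - 1 < N then k.val + m - 1 else k.val + m - 1 - N := by
    split_ifs with h h'
    · rw [h, Nat.mod_eq_of_lt] <;> omega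
    · rw [show k.val + m + N - 1 = k.val + m - 1 + N by omega, Nat.add_mod_right,
        Nat.mod_eq_of_lt h']
    · rw [show k.val + m + N - 1 = k.val + m - 1 - N + N + N by omega, Nat.add_mod_right,
        Nat.add_mod_right, Nat.mod_eq_of_lt]
      omega
  rw [Fin.pred_mod_eq_ite] at h₁
  rw [e₂] at h₂
  split_ifs at * <;> omega

/-- Beads of an arc that the cut before `k` does not meet compare in the same way, in the
rotated order starting at `k`, with every bead outside the arc. -/
theorem sub_lt_sub_iff_of_fibre {N s : ℕ} (hN : 0 < N) {arcIdx : Fin N → Fin s}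
    (hmono : ∀ x y : Fin N, x.val ≤ y.val → arcIdx x ≤ arcIdx y) {k x x' y : Fin N}
    (hxx' : arcIdx x = arcIdx x') (hxy : arcIdx x ≠ arcIdx y)
    (hk : arcIdx x ≠ arcIdx ⟨(k.val + N - 1) % N, Nat.mod_lt _ hN⟩) :
    (x - k).val < (y - k).val ↔ (x' - k).val < (y - k).val := by
  have h₁ := val_le_iff_of_fibre hmono hxx' hk
  have h₂ := val_le_iff_of_fibre hmono hxx' hxy
  have hne : x.val ≠ y.val := fun h => hxy (by rw [Fin.ext h])
  have hne' : x'.val ≠ y.val := fun h => hxy (by rw [hxx', Fin.ext h])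
  have := k.isLt
  have := x.isLt
  have := x'.isLt
  have := y.isLt
  simp only [Fin.val_sub_eq_ite] at *
  rw [Fin.pred_mod_eq_ite] at h₁
  split_ifs at * <;> omega

theorem strictBtw_of_sub_lt_of_sub_lt {N : ℕ} {k a x b : Fin N}
    (hax : (a - k).val < (x - k).val) (hxb : (x - k).val < (b - k).val) : strictBtw a x b := by
  have := k.isLt
  have := a.isLt
  have := x.isLt
  have := b.isLt
  simp only [strictBtw, Fin.val_sub_eq_ite] at *
  split_ifs at * <;> omega

theorem strictBtw_rotate {N : ℕ} {k a x b : Fin N}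
    (hax : (a - k).val < (x - k).val) (hxb : (x - k).val < (b - k).val) : strictBtw x b a := by
  have := k.isLt
  have := a.isLt
  have := x.isLt
  have := b.isLt
  simp only [strictBtw, Fin.val_sub_eq_ite] at *
  split_ifs at * <;> omega

/-- Pairs of a cross-free matching are nested or separated in the order starting at `k`. -/
theorem CrossFree.not_alternating {N : ℕ} {M : Finset (Fin N × Fin N)} (hcf : CrossFree M)
    {k a b c d : Fin N} (hab : (a, b) ∈ M ∨ (b, a) ∈ M) (hcd : (c, d) ∈ M ∨ (d, c) ∈ M)
    (hac : (a - k).val < (c - k).val) (hcb : (c - k).val < (b - k).val) :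
    (d - k).val ≤ (b - k).val := by
  by_contra! hbd
  have h₁ : strictBtw a c b := strictBtw_of_sub_lt_of_sub_lt hac hcb
  have h₂ : strictBtw b d a := strictBtw_rotate (hac.trans hcb) hbd
  rcases hab with hab | hab <;> rcases hcd with hcd | hcd
  · exact hcf _ hab _ hcd (Or.inl ⟨h₁, h₂⟩)
  · exact hcf _ hab _ hcd (Or.inr ⟨h₁, h₂⟩)
  · exact hcf _ hab _ hcd (Or.inr ⟨h₂, h₁⟩)
  · exact hcf _ hab _ hcd (Or.inl ⟨h₂, h₁⟩)

/-- if a necklace on N beads is partitioned in cyclic order into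
s ≥ 3 consecutive arcs (given by the monotone surjective assignment arcIdx),
and M is a cross-free matching respecting a secant whose two cut points are
assigned to arcs p and r with p ≠ r, then the graph on {1,…,s} ∖ {p,r} whose
edges are the bonded pairs is acyclic; in particular it has at most s − 3
edges. -/
theorem stmt9 {N s : ℕ} (hN : 0 < N) (hs : 3 ≤ s)
    (arcIdx : Fin N → Fin s)
    (hmono : ∀ x y : Fin N, x.val ≤ y.val → arcIdx x ≤ arcIdx y)
    (hsurj : Function.Surjective arcIdx)
    (M : Finset (Fin N × Fin N)) (hM : IsMatching M) (hcf : CrossFree M)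
    (k : Fin N) (m : ℕ) (hsec : RespectsSecant M k m)
    (p r : Fin s)
    -- the cut point before bead k is assigned to the arc of the preceding bead
    (hp : p = arcIdx ⟨(k.val + N - 1) % N, Nat.mod_lt _ hN⟩)
    -- likewise for the cut point before bead k + m
    (hr : r = arcIdx ⟨(k.val + m + N - 1) % N, Nat.mod_lt _ hN⟩)
    (hpr : p ≠ r) :
    ∀ G : SimpleGraph (Fin s),
      G = SimpleGraph.fromRel (fun g h =>
        g ≠ p ∧ g ≠ r ∧ h ≠ p ∧ h ≠ r ∧
        ∃ q ∈ M, arcIdx q.1 = g ∧ arcIdx q.2 = h) →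
      G.IsAcyclic ∧ G.edgeSet.ncard ≤ s - 3 := by
  rintro G rfl
  obtain ⟨-, hm, hxor⟩ := hsec
  subst hp hr
  set p := arcIdx ⟨(k.val + N - 1) % N, Nat.mod_lt _ hN⟩
  set r := arcIdx ⟨(k.val + m + N - 1) % N, Nat.mod_lt _ hN⟩
  set G := SimpleGraph.fromRel (fun g h =>
    g ≠ p ∧ g ≠ r ∧ h ≠ p ∧ h ≠ r ∧ ∃ q ∈ M, arcIdx q.1 = g ∧ arcIdx q.2 = h)
  have hadj : ∀ {g h}, G.Adj g h → g ≠ p ∧ g ≠ r ∧ h ≠ p ∧ h ≠ r ∧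
      ∃ x y, arcIdx x = g ∧ arcIdx y = h ∧ ((x, y) ∈ M ∨ (y, x) ∈ M) := by
    rintro g h ⟨-, ⟨h₁, h₂, h₃, h₄, q, hq, hg, hh⟩ | ⟨h₁, h₂, h₃, h₄, q, hq, hg, hh⟩⟩
    · exact ⟨h₁, h₂, h₃, h₄, q.1, q.2, hg, hh, Or.inl hq⟩
    · exact ⟨h₃, h₄, h₁, h₂, q.2, q.1, hh, hg, Or.inr hq⟩
  choose rep hrep using hsurj
  have side : ∀ {x}, arcIdx x ≠ p → arcIdx x ≠ r →
      ((rep (arcIdx x) - k).val < m ↔ (x - k).val < m) := fun hxp hxr =>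
    (inArc_iff_of_fibre hN hmono hm (hrep _).symm hxp hxr).symm
  have order : ∀ {x y}, arcIdx x ≠ p → arcIdx y ≠ p →
      (rep (arcIdx x) - k).val < (rep (arcIdx y) - k).val → (x - k).val < (y - k).val := by
    intro x y hx hy hlt
    have hxy : arcIdx x ≠ arcIdx y := fun h => by simp [h] at hlt
    have h₁ := (sub_lt_sub_iff_of_fibre (y := rep (arcIdx y)) hN hmono (hrep (arcIdx x)).symm
      (by rwa [hrep]) hx).mpr hlt
    by_contra! hle
    have hne : (y - k).val ≠ (x - k).val := fun h =>
      hxy (congrArg arcIdx (Fin.eq_of_val_sub_eq h.symm))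
    have h₂ := (sub_lt_sub_iff_of_fibre hN hmono (hrep (arcIdx y)).symm hxy.symm hy).mp
      (lt_of_le_of_ne hle hne)
    omega
  have opposite : ∀ {x y}, ((x, y) ∈ M ∨ (y, x) ∈ M) → ((x - k).val < m ↔ ¬ (y - k).val < m) := by
    rintro x y (h | h)
    · exact xor_iff_iff_not.mp (hxor _ h)
    · exact (xor_iff_not_iff'.mp (hxor _ h)).symm
  have hacyc : G.IsAcyclic := by
    refine SimpleGraph.isAcyclic_of_noncrossing (fun g => (rep g - k).val) m ?_ ?_ ?_ ?_
    · intro g h hgh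
      rw [← hrep g, ← hrep h]
      exact congrArg arcIdx (Fin.eq_of_val_sub_eq hgh)
    · intro g h hgh hlt
      obtain ⟨h₁, h₂, h₃, h₄, x, y, rfl, rfl, hxy⟩ := hadj hgh
      have := side h₁ h₂
      have := side h₃ h₄
      have := opposite hxy
      grind
    · intro g h hgh hlt
      obtain ⟨h₁, h₂, h₃, h₄, x, y, rfl, rfl, hxy⟩ := hadj hgh
      have := side h₁ h₂
      have := side h₃ h₄
      have := opposite hxy
      grind
    · intro g h g' h' hgh hgh' hlt hlt' hgg'
      obtain ⟨h₁, h₂, h₃, h₄, x, y, rfl, rfl, hxy⟩ := hadj hgh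
      obtain ⟨h₁', h₂', h₃', h₄', x', y', rfl, rfl, hxy'⟩ := hadj hgh'
      by_contra! hhh'
      have hxm := (side h₁' h₂').mp hlt'
      have hym := (opposite hxy).mp ((side h₁ h₂).mp hlt)
      exact absurd (hcf.not_alternating hxy hxy' (order h₁ h₁' hgg') (by omega))
        (order h₃ h₃' hhh').not_ge
  refine ⟨hacyc, ?_⟩
  have hcard : ({p, r}ᶜ : Set (Fin s)).ncard = s - 2 := by
    rw [Set.ncard_compl, Set.ncard_pair hpr, Nat.card_fin]
  have hsupp : G.support ⊆ {p, r}ᶜ := by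
    rintro g ⟨h, hgh⟩
    obtain ⟨h₁, h₂, -⟩ := hadj hgh
    simp [h₁, h₂]
  have := hacyc.ncard_edgeSet_lt_ncard_of_support_subset
    (Set.nonempty_of_ncard_ne_zero (by omega)) hsupp
  omega
end
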